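/- There exists a strong snark on 34 vertices, i.e. a snark G such that for every edge e of G the cubic graph G*e is uncolourable. -/

import Mathlib

open scoped Classical

namespace SnarkPaper

variable {V : Type*}

/-- A graph is cubic if every vertex has exactly 3 neighbours. -/
def IsCubic (G : SimpleGraph V) : Prop := ∀ v : V, (G.neighborSet v).ncard = 3

/-- A proper 3-edge-colouring: edges sharing an endpoint get different colours. -/
def Colourable3 (G : SimpleGraph V) : Prop :=
  ∃ c : Sym2 V → Fin 3, ∀ e₁ ∈ G.edgeSet, ∀ e₂ ∈ G.edgeSet,
    e₁ ≠ e₂ → (∃ v, v ∈ e₁ ∧ v ∈ e₂) → c e₁ ≠ c e₂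

/-- A subgraph is 2-regular if every one of its vertices has exactly two neighbours in it. -/
def IsTwoRegular {G : SimpleGraph V} (H : G.Subgraph) : Prop :=
  ∀ v ∈ H.verts, (H.neighborSet v).ncard = 2

/-- A cycle is a connected 2-regular subgraph. -/
def IsCycleSub {G : SimpleGraph V} (C : G.Subgraph) : Prop :=
  C.Connected ∧ IsTwoRegular C

/-- A 2-factor is a spanning 2-regular subgraph. -/
def IsTwoFactor {G : SimpleGraph V} (F : G.Subgraph) : Prop :=
  F.IsSpanning ∧ IsTwoRegular F

/-- A 2-factor is even if all its cycles (connected components) have even length. -/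
def IsEvenTwoFactor {G : SimpleGraph V} (F : G.Subgraph) : Prop :=
  IsTwoFactor F ∧ ∀ C : G.Subgraph, C ≤ F → IsCycleSub C → Even C.verts.ncard

/-- An even subgraph: every vertex has even degree. -/
def IsEvenSubgraph {G : SimpleGraph V} (H : G.Subgraph) : Prop :=
  ∀ v : V, Even (H.neighborSet v).ncard

/-- A cycle double cover: a multiset of cycles covering each edge exactly twice. -/
def IsCDC (G : SimpleGraph V) (D : Multiset G.Subgraph) : Prop :=
  (∀ C ∈ D, IsCycleSub C) ∧
  ∀ e ∈ G.edgeSet, D.countP (fun C => e ∈ C.edgeSet) = 2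

/-- A k-CDC, seen as a multiset of k even subgraphs covering each edge exactly twice. -/
def IsKCDC (G : SimpleGraph V) (k : ℕ) (D : Multiset G.Subgraph) : Prop :=
  D.card = k ∧ (∀ H ∈ D, IsEvenSubgraph H) ∧
  ∀ e ∈ G.edgeSet, D.countP (fun H => e ∈ H.edgeSet) = 2

/-- An edge set is even if every vertex meets an even number of its edges. -/
def EvenEdgeSet (S : Set (Sym2 V)) : Prop :=
  ∀ v : V, Even {w : V | s(v, w) ∈ S}.ncard

/-- A k-CDC presented as a multiset of k even edge sets covering each edge exactly twice. -/
def IsKCDCEdgeSets (G : SimpleGraph V) (k : ℕ) (D : Multiset (Set (Sym2 V))) : Prop :=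
  D.card = k ∧ (∀ S ∈ D, S ⊆ G.edgeSet ∧ EvenEdgeSet S) ∧
  ∀ e ∈ G.edgeSet, D.countP (fun S => e ∈ S) = 2

/-- The set A contains (the vertices of) a cycle of G. -/
def HasCycleIn (G : SimpleGraph V) (A : Set V) : Prop :=
  ∃ C : G.Subgraph, IsCycleSub C ∧ C.verts ⊆ A

/-- The edges of G crossing between A and its complement. -/
def cutEdges (G : SimpleGraph V) (A : Set V) : Set (Sym2 V) :=
  {e ∈ G.edgeSet | ∃ x ∈ A, ∃ y ∉ A, e = s(x, y)}

/-- Cyclically k-edge-connected: every edge cut separating two cycles has at least k edges. -/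
def CyclEdgeConn (G : SimpleGraph V) (k : ℕ) : Prop :=
  ∀ A : Set V, HasCycleIn G A → HasCycleIn G Aᶜ → k ≤ (cutEdges G A).ncard

/-- A snark: an uncolourable cyclically 4-edge-connected cubic graph with girth at least 5. -/
def IsSnark (G : SimpleGraph V) : Prop :=
  IsCubic G ∧ ¬ Colourable3 G ∧ CyclEdgeConn G 4 ∧ 5 ≤ G.girth

/-- The edge-insertion operation applied to the edges ab and cd of G: subdivide each with a
new vertex (u = inr 0, v = inr 1) and join the two new vertices by an edge. -/
def edgeInsertion (G : SimpleGraph V) (a b c d : V) : SimpleGraph (V ⊕ Fin 2) :=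
  SimpleGraph.fromEdgeSet
    ((Sym2.map Sum.inl '' (G.edgeSet \ {s(a, b), s(c, d)})) ∪
      {s(Sum.inl a, Sum.inr 0), s(Sum.inr 0, Sum.inl b),
       s(Sum.inl c, Sum.inr 1), s(Sum.inr 1, Sum.inl d),
       s(Sum.inr 0, Sum.inr 1)})

/-- A permutation graph: a cubic graph with a 2-factor consisting of two induced cycles. -/
def IsPermutationGraph (G : SimpleGraph V) : Prop :=
  IsCubic G ∧ ∃ C₁ C₂ : G.Subgraph, IsCycleSub C₁ ∧ IsCycleSub C₂ ∧
    C₁.IsInduced ∧ C₂.IsInduced ∧ Disjoint C₁.verts C₂.verts ∧ IsTwoFactor (C₁ ⊔ C₂)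

/-- The total weight of the edge cut determined by A. -/
noncomputable def cutWeight (G : SimpleGraph V) (w : Sym2 V → ℕ) (A : Set V) : ℕ :=
  ∑ᶠ e ∈ cutEdges G A, w e

/-- An eulerian (1,2)-weight: each edge gets weight 1 or 2 and every edge cut has even weight. -/
def IsEulerianWeight (G : SimpleGraph V) (w : Sym2 V → ℕ) : Prop :=
  (∀ e ∈ G.edgeSet, w e = 1 ∨ w e = 2) ∧ ∀ A : Set V, Even (cutWeight G w A)

/-- A compatible cycle cover of (G, w): each edge e lies in exactly w(e) of the cycles. -/
def IsCompatibleCycleCover (G : SimpleGraph V) (w : Sym2 V → ℕ)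
    (D : Multiset G.Subgraph) : Prop :=
  (∀ C ∈ D, IsCycleSub C) ∧
  ∀ e ∈ G.edgeSet, D.countP (fun C => e ∈ C.edgeSet) = w e


/-- The construction sequence: each vertex with the list of its smaller neighbours. -/
def steps : List (ℕ × List ℕ) :=
  [(0, []), (1, [0]), (2, [0]), (3, [1]), (4, [2, 3]), (5, [3]), (6, [2, 5]), (7, [0, 5]),
   (8, [6]), (9, [8]), (10, [1, 9]), (11, [4]), (12, [11]), (13, [7, 12]), (14, [9, 12]),
   (15, [11]), (16, [13]), (17, [16]), (18, [15, 17]), (19, [15]), (20, [16, 19]),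
   (21, [18, 20]), (22, [17, 19]), (23, [14]), (24, [21, 23]), (25, [22, 23]), (26, [25]),
   (27, [8]), (28, [26, 27]), (29, [10]), (30, [26, 29]), (31, [28, 29]), (32, [24, 31]),
   (33, [27, 30, 32])]

/-- The edges of the graph, in an order suited to a backtracking search for 3-edge-colourings. -/
def edgeOrder : List (ℕ × ℕ) :=
  [(3, 4), (4, 11), (2, 4), (1, 3), (3, 5), (0, 1), (1, 10), (0, 2), (0, 7), (2, 6), (5, 7),
   (5, 6), (6, 8), (7, 13), (13, 16), (12, 13), (11, 12), (12, 14), (11, 15), (16, 20),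
   (16, 17), (19, 20), (20, 21), (15, 19), (15, 18), (19, 22), (17, 22), (17, 18), (18, 21),
   (22, 25), (21, 24), (10, 29), (9, 10), (8, 9), (9, 14), (8, 27), (14, 23), (23, 24),
   (23, 25), (24, 32), (25, 26), (26, 30), (26, 28), (29, 30), (30, 33), (29, 31), (27, 28),
   (28, 31), (31, 32), (32, 33), (27, 33)]

/-! ### The graph -/

/-- Edge list read off from the construction sequence. -/
def stepEdges (l : List (ℕ × List ℕ)) : List (ℕ × ℕ) :=
  l.flatMap fun p => p.2.map fun j => (j, p.1)

theorem perm_edges : (stepEdges steps).Perm edgeOrder := by decide +kernel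

theorem edge_lt : ∀ e ∈ edgeOrder, e.1 < e.2 ∧ e.2 < 34 := by decide +kernel

theorem edgeOrder_nodup : edgeOrder.Nodup := by decide +kernel

/-- The strong snark. -/
def G34 : SimpleGraph (Fin 34) where
  Adj u v := (u.val, v.val) ∈ edgeOrder ∨ (v.val, u.val) ∈ edgeOrder
  symm := ⟨fun _ _ h => h.symm⟩
  loopless := ⟨fun u h => by
    rcases h with h | h <;> exact absurd (edge_lt _ h).1 (lt_irrefl _)⟩

instance decAdj (u v : Fin 34) : Decidable (G34.Adj u v) :=
  inferInstanceAs (Decidable ((u.val, v.val) ∈ edgeOrder ∨ (v.val, u.val) ∈ edgeOrder))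

/-- Neighbours of a vertex, as a list. -/
def nbL (u : Fin 34) : List (Fin 34) :=
  edgeOrder.filterMap fun e =>
    bif e.1.beq u.val then some (Fin.ofNat 34 e.2)
    else bif e.2.beq u.val then some (Fin.ofNat 34 e.1) else none

theorem ofNat_val (u : Fin 34) : Fin.ofNat 34 u.val = u := by
  ext; simp [Fin.ofNat]

theorem val_ofNat {n : ℕ} (h : n < 34) : (Fin.ofNat 34 n).val = n := by
  simp [Fin.ofNat, Nat.mod_eq_of_lt h]

theorem mem_nbL {u v : Fin 34} : v ∈ nbL u ↔ G34.Adj u v := by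
  unfold nbL
  rw [List.mem_filterMap]
  constructor
  · rintro ⟨⟨p, q⟩, he, h⟩
    have hl := edge_lt _ he
    simp only at h hl
    cases h1 : p.beq u.val with
    | true =>
      rw [h1] at h
      have h1 := Nat.eq_of_beq_eq_true h1
      simp only [cond_true, Option.some.injEq] at h
      subst h
      left
      rw [val_ofNat hl.2, ← h1]
      exact he
    | false =>
      rw [h1] at h
      cases h2 : q.beq u.val with
      | true =>
        rw [h2] at h
        have h2 := Nat.eq_of_beq_eq_true h2
        simp only [cond_true, cond_false, Option.some.injEq] at h
        subst h
        right
        rw [val_ofNat (hl.1.trans hl.2), ← h2]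
        exact he
      | false => simp [h2] at h
  · rintro (h | h)
    · refine ⟨_, h, ?_⟩
      simp
    · refine ⟨_, h, ?_⟩
      have : (v.val).beq u.val = false := by
        have := (edge_lt _ h).1
        rw [← Bool.not_eq_true, Nat.beq_eq]
        exact this.ne
      simp [this]

theorem nbL_card : ∀ u : Fin 34, (nbL u).toFinset.card = 3 := by decide +kernel

theorem cubic34 : IsCubic G34 := by
  intro v
  have : G34.neighborSet v = ((nbL v).toFinset : Set (Fin 34)) := by
    ext w
    simp [mem_nbL]
  rw [this, Set.ncard_coe_finset]
  exact nbL_card v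

theorem no_short : ∀ a : Fin 34, ∀ b ∈ nbL a, ∀ c ∈ nbL b, c ≠ a → c ∉ nbL a ∧
    ∀ d ∈ nbL c, d ≠ b → a ∉ nbL d := by decide +kernel

theorem girth34 : 5 ≤ G34.girth := by
  have hcyc : ¬ G34.IsAcyclic := by
    intro h
    have h01 : G34.Adj 0 1 := by decide +kernel
    have h13 : G34.Adj 1 3 := by decide +kernel
    have h35 : G34.Adj 3 5 := by decide +kernel
    have h57 : G34.Adj 5 7 := by decide +kernel
    have h70 : G34.Adj 7 0 := by decide +kernel
    refine h (.cons h01 (.cons h13 (.cons h35 (.cons h57 (.cons h70 .nil))))) ?_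
    rw [SimpleGraph.Walk.cons_isCycle_iff]
    constructor
    · simp [SimpleGraph.Walk.isPath_def]
    · simp
  have he : (5 : ℕ∞) ≤ G34.egirth := by
    rw [SimpleGraph.le_egirth]
    intro a w hw
    by_contra hlt
    have h3 := hw.three_le_length
    have hlt : w.length < 5 := by exact_mod_cast not_le.mp hlt
    match w, hw, h3, hlt with
    | .cons h1 (.cons h2 (.cons h3 .nil)), hw, _, _ =>
      exact (no_short _ _ (mem_nbL.2 h1) _ (mem_nbL.2 h2) h3.ne).1 (mem_nbL.2 h3.symm)
    | .cons (v := b) h1 (.cons (v := c) h2 (.cons (v := d) h3 (.cons h4 .nil))), hw, _, _ =>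
      have hn := hw.support_nodup
      simp at hn
      refine (no_short _ _ (mem_nbL.2 h1) _ (mem_nbL.2 h2) ?_).2 _ (mem_nbL.2 h3) ?_ (mem_nbL.2 h4)
      · grind
      · grind
  have ht : G34.egirth ≠ ⊤ := by
    rwa [Ne, SimpleGraph.egirth_eq_top]
  have := ENat.toNat_le_toNat he ht
  exact this

/-! ### Cyclic edge-connectivity -/

/-- Branch over all vertex bipartitions with at most three crossing edges; check that each
has all vertices but at most one on the same side. -/
def cutB : List (ℕ × List ℕ) → List Bool → ℕ → Bool
  | [], bs, _ => [true, false].any fun b => (List.range 34).any fun i =>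
      (List.range 34).all fun j => j.beq i || bs.getD j false == b
  | p :: ls, bs, k =>
    [true, false].all fun b =>
      (Nat.blt 3 (k + p.2.countP fun j => bs.getD j false != b)) ||
        cutB ls (bs ++ [b]) (k + p.2.countP fun j => bs.getD j false != b)

theorem cutB_steps : cutB steps [] 0 = true := by decide +kernel

theorem cutB_sound (g : ℕ → Bool) (ls : List (ℕ × List ℕ)) : ∀ (n k : ℕ),
    ls.map Prod.fst = List.range' n ls.length → (∀ p ∈ ls, ∀ j ∈ p.2, j < p.1) →
    n + ls.length = 34 →
    cutB ls ((List.range n).map g) k = true →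
    k + (stepEdges ls).countP (fun e => g e.1 != g e.2) ≤ 3 →
    ∃ b : Bool, ∃ i < 34, ∀ j < 34, j ≠ i → g j = b := by
  induction ls with
  | nil =>
    intro n k _ _ hn h _
    simp only [List.length_nil, add_zero] at hn
    subst hn
    simp only [cutB, List.any_eq_true, List.all_eq_true, List.mem_range, Bool.or_eq_true,
      Nat.beq_eq, beq_iff_eq] at h
    obtain ⟨b, _, i, hi, h⟩ := h
    refine ⟨b, i, hi, fun j hj hji => ?_⟩
    have := (h j hj).resolve_left hji
    simpa [hj] using this
  | cons p ls ih =>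
    intro n k h1 h2 hn h hk
    simp only [List.map_cons, List.length_cons, List.range'_succ, List.cons.injEq] at h1
    obtain ⟨h1, h1'⟩ := h1
    simp only [List.length_cons] at hn
    have hc : (p.2.countP fun j => ((List.range n).map g).getD j false != g n) =
        p.2.countP fun j => g j != g p.1 := by
      apply List.countP_congr
      intro j hj
      have : j < n := h1 ▸ h2 p (by simp) j hj
      simp [this, h1]
    have hs : (stepEdges (p :: ls)).countP (fun e => g e.1 != g e.2) =
        (p.2.countP fun j => g j != g p.1) +
          (stepEdges ls).countP (fun e => g e.1 != g e.2) := by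
      simp only [stepEdges, List.flatMap_cons, List.countP_append, List.countP_map]
      rfl
    rw [hs] at hk
    simp only [cutB, List.all_eq_true] at h
    have h := h (g n) (by cases g n <;> simp)
    rw [hc, Bool.or_eq_true] at h
    rcases h with h | h
    · have := Nat.blt_eq.mp h
      omega
    · refine ih (n + 1) (k + p.2.countP fun j => g j != g p.1) h1' (fun q hq => h2 q (by simp [hq])) (by omega) ?_ ?_
      · rw [List.range_succ, List.map_append]
        exact h
      · omega

theorem two_of_cycle {A : Set (Fin 34)} (h : HasCycleIn G34 A) : ∃ x ∈ A, ∃ y ∈ A, x ≠ y := by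
  obtain ⟨C, ⟨hc, hr⟩, hA⟩ := h
  obtain ⟨v, hv⟩ := hc.nonempty
  obtain ⟨x, y, hxy, hN⟩ := Set.ncard_eq_two.mp (hr v hv)
  have hx : x ∈ C.neighborSet v := by rw [hN]; simp
  have hy : y ∈ C.neighborSet v := by rw [hN]; simp
  exact ⟨x, hA (C.edge_vert (C.adj_symm hx)), y, hA (C.edge_vert (C.adj_symm hy)), hxy⟩

/-- A pair of naturals as an unordered pair of vertices. -/
def toS (p : ℕ × ℕ) : Sym2 (Fin 34) := s(Fin.ofNat 34 p.1, Fin.ofNat 34 p.2)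

theorem toS_inj {p q : ℕ × ℕ} (hp : p.1 < p.2 ∧ p.2 < 34) (hq : q.1 < q.2 ∧ q.2 < 34)
    (h : toS p = toS q) : p = q := by
  obtain ⟨a, b⟩ := p
  obtain ⟨c, d⟩ := q
  simp only at hp hq
  simp only [toS, Sym2.eq_iff, Fin.ext_iff, val_ofNat hp.2, val_ofNat hq.2,
    val_ofNat (hp.1.trans hp.2), val_ofNat (hq.1.trans hq.2)] at h
  ext <;> simp only <;> omega

theorem adj_of_mem {p : ℕ × ℕ} (hp : p ∈ edgeOrder) :
    G34.Adj (Fin.ofNat 34 p.1) (Fin.ofNat 34 p.2) := by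
  have := edge_lt p hp
  left
  rw [val_ofNat this.2, val_ofNat (this.1.trans this.2)]
  exact hp

theorem cut34 : CyclEdgeConn G34 4 := by
  intro A h1 h2
  by_contra hlt
  set g : ℕ → Bool := fun n => decide (Fin.ofNat 34 n ∈ A) with hg
  have hcount : edgeOrder.countP (fun e => g e.1 != g e.2) ≤ (cutEdges G34 A).ncard := by
    set l := (edgeOrder.filter (fun e => g e.1 != g e.2)).map toS with hl
    have hnd : l.Nodup := by
      refine List.Nodup.map_on ?_ (edgeOrder_nodup.filter _)
      intro p hp q hq h
      exact toS_inj (edge_lt _ (List.mem_of_mem_filter hp)) (edge_lt _ (List.mem_of_mem_filter hq)) h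
    have hlen : edgeOrder.countP (fun e => g e.1 != g e.2) = l.toFinset.card := by
      rw [List.toFinset_card_of_nodup hnd, hl, List.length_map, List.countP_eq_length_filter]
    rw [hlen, ← Set.ncard_coe_finset]
    refine Set.ncard_le_ncard ?_ (Set.toFinite _)
    intro e he
    simp only [List.coe_toFinset, Set.mem_ofPred_eq, hl, List.mem_map, List.mem_filter] at he
    obtain ⟨p, ⟨hp, hd⟩, rfl⟩ := he
    refine ⟨adj_of_mem hp, ?_⟩
    simp only [hg, bne_iff_ne, ne_eq, decide_eq_decide] at hd
    by_cases hA : Fin.ofNat 34 p.1 ∈ A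
    · by_cases hB : Fin.ofNat 34 p.2 ∈ A
      · exact absurd (by simp only [hA, hB]) hd
      · exact ⟨_, hA, _, hB, rfl⟩
    · by_cases hB : Fin.ofNat 34 p.2 ∈ A
      · exact ⟨_, hB, _, hA, Sym2.eq_swap⟩
      · exact absurd (by simp only [hA, hB]) hd
  have key := cutB_sound g steps 0 0 (by decide +kernel) (by decide +kernel) (by decide +kernel)
    cutB_steps (by rw [perm_edges.countP_eq]; omega)
  obtain ⟨b, i, _, hb⟩ := key
  obtain ⟨x, hx, y, hy, hxy⟩ := two_of_cycle h1
  obtain ⟨z, hz, w, hw, hzw⟩ := two_of_cycle h2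
  have gx : g x.val = true := by simp only [hg, ofNat_val]; simpa using hx
  have gy : g y.val = true := by simp only [hg, ofNat_val]; simpa using hy
  have gz : g z.val = false := by simp only [hg, ofNat_val]; simpa using hz
  have gw : g w.val = false := by simp only [hg, ofNat_val]; simpa using hw
  have bx := hb x.val x.isLt
  have bb := hb y.val y.isLt
  have bz := hb z.val z.isLt
  have bw := hb w.val w.isLt
  have n1 : x.val ≠ y.val := fun h => hxy (Fin.ext h)
  have n2 : z.val ≠ w.val := fun h => hzw (Fin.ext h)
  grind

/-! ### Colourings -/

/-- Bit mask of an edge: three bits for each vertex. -/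
def mask (p : ℕ × ℕ) : ℕ := 2 ^ (3 * p.1) ||| 2 ^ (3 * p.2)

/-- Evaluate the argument before passing it on (speeds up kernel evaluation). -/
def force {α : Type} (n : ℕ) (f : ℕ → α) : α := Nat.rec (f 0) (fun m _ => f (m + 1)) n

theorem force_eq {α : Type} (n : ℕ) (f : ℕ → α) : force n f = f n := by
  cases n <;> rfl

/-- Backtracking search for a proper 3-edge-colouring. -/
def col (l : List ℕ) : ℕ → Bool :=
  List.rec (fun _ => true) (fun m _ ih s =>
    force s fun s =>
    ((s &&& m).beq 0 && ih (s ||| m)) ||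
    ((s &&& (m <<< 1)).beq 0 && ih (s ||| (m <<< 1))) ||
    ((s &&& (m <<< 2)).beq 0 && ih (s ||| (m <<< 2)))) l

theorem col_cons (m : ℕ) (l : List ℕ) (s : ℕ) (k : Fin 3) (h0 : s &&& (m <<< k.val) = 0)
    (h : col l (s ||| (m <<< k.val)) = true) : col (m :: l) s = true := by
  have hu : col (m :: l) s = force s fun s =>
    ((s &&& m).beq 0 && col l (s ||| m)) ||
    ((s &&& (m <<< 1)).beq 0 && col l (s ||| (m <<< 1))) ||
    ((s &&& (m <<< 2)).beq 0 && col l (s ||| (m <<< 2))) := rfl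
  rw [hu, force_eq]
  have hz : ∀ n : ℕ, n = 0 → n.beq 0 = true := by rintro _ rfl; rfl
  fin_cases k
  · simp only [Nat.shiftLeft_zero] at h0 h
    simp [hz _ h0, h]
  · simp only at h0 h
    simp [hz _ h0, h]
  · simp only at h0 h
    simp [hz _ h0, h]

theorem testBit_mask (p : ℕ × ℕ) (k : Fin 3) (i : ℕ) (h : (mask p <<< k.val).testBit i = true) :
    i = 3 * p.1 + k.val ∨ i = 3 * p.2 + k.val := by
  simp only [Nat.testBit_shiftLeft, mask, Nat.testBit_or, Nat.testBit_two_pow, Bool.and_eq_true,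
    Bool.or_eq_true, decide_eq_true_eq] at h
  omega

theorem mask_disjoint (p q : ℕ × ℕ) (k m : Fin 3)
    (h : (p.1 = q.1 ∨ p.1 = q.2 ∨ p.2 = q.1 ∨ p.2 = q.2) → k ≠ m) :
    (mask p <<< k.val) &&& (mask q <<< m.val) = 0 := by
  apply Nat.eq_of_testBit_eq
  intro i
  rw [Nat.testBit_and, Nat.zero_testBit]
  by_contra hne
  rw [Bool.not_eq_false, Bool.and_eq_true] at hne
  have h1 := testBit_mask p k i hne.1
  have h2 := testBit_mask q m i hne.2
  have hk := k.isLt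
  have hm := m.isLt
  refine h ?_ (Fin.ext ?_) <;> omega

theorem col_sound_aux (c : ℕ × ℕ → Fin 3) (l : List (ℕ × ℕ)) : ∀ s : ℕ,
    l.Pairwise (fun p q => (p.1 = q.1 ∨ p.1 = q.2 ∨ p.2 = q.1 ∨ p.2 = q.2) → c p ≠ c q) →
    (∀ p ∈ l, s &&& (mask p <<< (c p).val) = 0) → col (l.map mask) s = true := by
  induction l with
  | nil => intro s _ _; rfl
  | cons p l ih =>
    intro s hp hs
    rw [List.pairwise_cons] at hp
    rw [List.map_cons]
    refine col_cons _ _ _ (c p) (hs p (by simp)) (ih _ hp.2 ?_)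
    intro q hq
    rw [Nat.and_or_distrib_right, hs q (by simp [hq]), mask_disjoint p q _ _ (hp.1 q hq)]
    rfl

theorem col_sound (H : SimpleGraph (Fin 34)) (l : List (ℕ × ℕ))
    (hl : ∀ p ∈ l, (p.1 < p.2 ∧ p.2 < 34) ∧ toS p ∈ H.edgeSet) (hn : l.Nodup)
    (hc : Colourable3 H) : col (l.map mask) 0 = true := by
  obtain ⟨c, hc⟩ := hc
  refine col_sound_aux (fun p => c (toS p)) l 0 ?_ (by simp)
  refine List.Pairwise.imp_of_mem ?_ hn
  intro p q hp hq hpq hsh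
  have h1 := hl p hp
  have h2 := hl q hq
  refine hc _ h1.2 _ h2.2 (fun h => hpq (toS_inj h1.1 h2.1 h)) ?_
  simp only [toS, Sym2.mem_iff]
  rcases hsh with h | h | h | h
  · exact ⟨_, Or.inl rfl, Or.inl (by rw [h])⟩
  · exact ⟨_, Or.inl rfl, Or.inr (by rw [h])⟩
  · exact ⟨_, Or.inr rfl, Or.inl (by rw [h])⟩
  · exact ⟨_, Or.inr rfl, Or.inr (by rw [h])⟩

theorem col_G34 : col (edgeOrder.map mask) 0 = false := by decide +kernel

theorem uncolourable34 : ¬ Colourable3 G34 := by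
  intro h
  have := col_sound G34 edgeOrder (fun p hp => ⟨edge_lt p hp, adj_of_mem hp⟩) edgeOrder_nodup h
  rw [col_G34] at this
  exact absurd this (by simp)

/-! ### Edge deletions -/

/-- The two neighbours of `a` other than `b`, in increasing order. -/
def other (a b : ℕ) : ℕ × ℕ :=
  match edgeOrder.filterMap (fun e =>
      bif e.1.beq a then (bif e.2.beq b then none else some e.2)
      else bif e.2.beq a then (bif e.1.beq b then none else some e.1) else none) with
  | [x, y] => bif x.ble y then (x, y) else (y, x)
  | _ => (0, 0)

/-- The edges of `G34 * ab`, ordered for the search. -/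
def stList (a b : ℕ) (x z : ℕ × ℕ) : List (ℕ × ℕ) :=
  edgeOrder.filterMap fun e =>
    bif (e.1.beq a && e.2.beq b) then none
    else bif (e.1.beq a && e.2.beq x.1 || e.2.beq a && e.1.beq x.1) then some x
    else bif (e.1.beq b && e.2.beq z.1 || e.2.beq b && e.1.beq z.1) then some z
    else bif (e.1.beq a || e.1.beq b || e.2.beq a || e.2.beq b) then none else some e

theorem mem_stList {a b : ℕ} {x z p : ℕ × ℕ} (h : p ∈ stList a b x z) :
    p = x ∨ p = z ∨ (p ∈ edgeOrder ∧ p.1 ≠ a ∧ p.1 ≠ b ∧ p.2 ≠ a ∧ p.2 ≠ b) := by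
  unfold stList at h
  rw [List.mem_filterMap] at h
  obtain ⟨e, he, h⟩ := h
  simp only [Bool.cond_eq_ite] at h
  split_ifs at h with h1 h2 h3 h4
  · left; simpa using h.symm
  · right; left; simpa using h.symm
  · right; right
    simp only [Option.some.injEq] at h
    subst h
    refine ⟨he, ?_⟩
    simp only [Bool.or_eq_true, Nat.beq_eq, not_or] at h4
    tauto

theorem stList_nodup : ∀ e ∈ edgeOrder,
    ((stList e.1 e.2 (other e.1 e.2) (other e.2 e.1)).map fun p => 34 * p.1 + p.2).Nodup := by
  decide +kernel

theorem other_spec : ∀ e ∈ edgeOrder,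
    ((other e.1 e.2).1 < (other e.1 e.2).2 ∧ (other e.1 e.2).2 < 34) ∧
    ((other e.2 e.1).1 < (other e.2 e.1).2 ∧ (other e.2 e.1).2 < 34) ∧
    ((other e.1 e.2).1 ≠ e.2 ∧ (other e.1 e.2).2 ≠ e.2) ∧
    ((other e.2 e.1).1 ≠ e.1 ∧ (other e.2 e.1).2 ≠ e.1) ∧
    (G34.Adj (Fin.ofNat 34 e.1) (Fin.ofNat 34 (other e.1 e.2).1) ∧
      G34.Adj (Fin.ofNat 34 e.1) (Fin.ofNat 34 (other e.1 e.2).2)) ∧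
    (G34.Adj (Fin.ofNat 34 e.2) (Fin.ofNat 34 (other e.2 e.1).1) ∧
      G34.Adj (Fin.ofNat 34 e.2) (Fin.ofNat 34 (other e.2 e.1).2)) := by
  decide +kernel

theorem col_star : (edgeOrder.all fun e =>
    !(col ((stList e.1 e.2 (other e.1 e.2) (other e.2 e.1)).map mask) 0)) = true := by
  decide +kernel

theorem pair_eq {a b x y : Fin 34} {p : ℕ × ℕ} (hN : G34.neighborSet a = {b, x, y})
    (hp : p.1 < p.2 ∧ p.2 < 34) (h1 : p.1 ≠ b.val) (h2 : p.2 ≠ b.val)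
    (h3 : G34.Adj a (Fin.ofNat 34 p.1)) (h4 : G34.Adj a (Fin.ofNat 34 p.2)) :
    toS p = s(x, y) := by
  have e1 : Fin.ofNat 34 p.1 ∈ G34.neighborSet a := h3
  have e2 : Fin.ofNat 34 p.2 ∈ G34.neighborSet a := h4
  have v1 := val_ofNat (hp.1.trans hp.2)
  have v2 := val_ofNat hp.2
  rw [hN] at e1 e2
  simp only [Set.mem_insert_iff, Set.mem_singleton_iff] at e1 e2
  simp only [toS, Sym2.eq_iff]
  generalize Fin.ofNat 34 p.1 = u at *
  generalize Fin.ofNat 34 p.2 = v at *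
  have n1 : u ≠ b := by rintro rfl; omega
  have n2 : v ≠ b := by rintro rfl; omega
  have n3 : u ≠ v := by rintro rfl; omega
  grind

theorem star_aux (a b : Fin 34) (hab : (a.val, b.val) ∈ edgeOrder) (x y z w : Fin 34)
    (ha : G34.neighborSet a = {b, x, y}) (hb : G34.neighborSet b = {a, z, w}) :
    ¬ Colourable3 (SimpleGraph.fromEdgeSet
      ({e ∈ G34.edgeSet | a ∉ e ∧ b ∉ e} ∪ {s(x, y), s(z, w)})) := by
  intro hc
  obtain ⟨s1, s2, ⟨s3, s4⟩, ⟨s5, s6⟩, ⟨s7, s8⟩, s9, s10⟩ := other_spec _ hab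
  simp only [ofNat_val] at s7 s8 s9 s10
  have hx := pair_eq ha s1 s3 s4 s7 s8
  have hz := pair_eq hb s2 s5 s6 s9 s10
  have hcol := List.all_eq_true.mp col_star _ hab
  have := col_sound _ (stList a.val b.val (other a.val b.val) (other b.val a.val)) ?_
    (List.Nodup.of_map _ (stList_nodup _ hab)) hc
  · simp [this] at hcol
  have nd : ∀ p : ℕ × ℕ, p.1 < p.2 ∧ p.2 < 34 → ¬ (toS p).IsDiag := by
    intro p hp h
    simp only [toS, Sym2.mk_isDiag_iff, Fin.ext_iff, val_ofNat hp.2,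
      val_ofNat (hp.1.trans hp.2)] at h
    omega
  intro p hp
  rw [SimpleGraph.edgeSet_fromEdgeSet]
  rcases mem_stList hp with rfl | rfl | ⟨hm, n1, n2, n3, n4⟩
  · exact ⟨s1, by rw [hx]; simp, nd _ s1⟩
  · exact ⟨s2, by rw [hz]; simp, nd _ s2⟩
  · have hlt := edge_lt p hm
    refine ⟨hlt, Or.inl ⟨adj_of_mem hm, ?_, ?_⟩, nd _ hlt⟩
    · simp only [toS, Sym2.mem_iff, Fin.ext_iff, val_ofNat hlt.2, val_ofNat (hlt.1.trans hlt.2)]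
      omega
    · simp only [toS, Sym2.mem_iff, Fin.ext_iff, val_ofNat hlt.2, val_ofNat (hlt.1.trans hlt.2)]
      omega

/-- there exists a strong snark on 34 vertices: a snark G such that for every
edge ab of G the graph G*ab (delete ab and suppress the two degree-2 vertices) is
uncolourable. -/
theorem exists_strong_snark_34 :
    ∃ G : SimpleGraph (Fin 34), IsSnark G ∧
      ∀ a b : Fin 34, G.Adj a b →
        ∀ x y z w : Fin 34, x ≠ y → z ≠ w →
          G.neighborSet a = {b, x, y} → G.neighborSet b = {a, z, w} →
          ¬ Colourable3 (SimpleGraph.fromEdgeSet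
            ({e ∈ G.edgeSet | a ∉ e ∧ b ∉ e} ∪ {s(x, y), s(z, w)})) := by
  refine ⟨G34, ⟨cubic34, uncolourable34, cut34, girth34⟩, ?_⟩
  intro a b hab x y z w _ _ ha hb
  rcases hab with hab | hab
  · exact star_aux a b hab x y z w ha hb
  · have := star_aux b a hab z w x y hb ha
    rw [Set.pair_comm]
    simpa only [and_comm] using this

end SnarkPaper
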